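/- Let ε = {ε_Q}_{Q∈𝒟} be a collection of positive real numbers indexed by the dyadic cubes of ℝⁿ and let p be an exponent function on ℝⁿ with 1 < p_- ≤ p_+ < ∞, with conjugate exponent function p' defined pointwise by 1/p'(x) = 1 − 1/p(x). Then p ∈ εLH_0(ℝⁿ) if and only if p' ∈ εLH_0(ℝⁿ). -/

import Mathlib

open MeasureTheory Set ENNReal

noncomputable section

/-- The dyadic cube in `ℝⁿ` with side length `2^(-k)` and lower-left corner `2^(-k) • m`. -/
def dyadicCube (n : ℕ) (k : ℤ) (m : Fin n → ℤ) : Set (Fin n → ℝ) :=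
  {x | ∀ i, (2 : ℝ) ^ (-k) * m i ≤ x i ∧ x i < (2 : ℝ) ^ (-k) * (m i + 1)}

/-- `Q` is a dyadic cube in `ℝⁿ`. -/
def IsDyadicCube (n : ℕ) (Q : Set (Fin n → ℝ)) : Prop :=
  ∃ (k : ℤ) (m : Fin n → ℤ), Q = dyadicCube n k m

/-- The conjugate exponent map is involutive, also at its junk values `0` and `1`. -/
lemma inv_one_sub_inv_involutive : Function.Involutive fun r : ℝ => (1 - r⁻¹)⁻¹ := by
  intro r
  simp

lemma inv_one_sub_inv_anti {r s : ℝ} (hr : 1 < r) (hrs : r ≤ s) :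
    (1 - s⁻¹)⁻¹ ≤ (1 - r⁻¹)⁻¹ := by
  have h1 : r⁻¹ < 1 := inv_lt_one_of_one_lt₀ hr
  have h2 : s⁻¹ ≤ r⁻¹ := inv_anti₀ (by linarith) hrs
  exact inv_anti₀ (by linarith) (by linarith)

lemma one_lt_inv_one_sub_inv {r : ℝ} (hr : 1 < r) : 1 < (1 - r⁻¹)⁻¹ := by
  have h1 : r⁻¹ < 1 := inv_lt_one_of_one_lt₀ hr
  have h2 : 0 < r⁻¹ := by positivity
  exact (one_lt_inv₀ (by linarith)).2 (by linarith)

section EssBounds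

variable {α : Type*} [MeasurableSpace α] {μ : Measure α} [NeZero μ] {f : α → ℝ} {l B : ℝ}

lemma le_essInf_of_ae_bounds (hl : ∀ᵐ x ∂μ, l ≤ f x) (hB : ∀ᵐ x ∂μ, f x ≤ B) :
    l ≤ essInf f μ :=
  Filter.le_liminf_of_le (Filter.isCoboundedUnder_ge_of_eventually_le _ hB) hl

lemma essSup_le_of_ae_bounds (hl : ∀ᵐ x ∂μ, l ≤ f x) (hB : ∀ᵐ x ∂μ, f x ≤ B) :
    essSup f μ ≤ B :=
  Filter.limsup_le_of_le (Filter.isCoboundedUnder_le_of_eventually_le _ hl) hB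

lemma essInf_le_essSup_of_ae_bounds (hl : ∀ᵐ x ∂μ, l ≤ f x) (hB : ∀ᵐ x ∂μ, f x ≤ B) :
    essInf f μ ≤ essSup f μ :=
  Filter.liminf_le_limsup ⟨B, hB⟩ ⟨l, hl⟩

lemma essInf_inv_one_sub_inv (h1 : 1 < l) (hl : ∀ᵐ x ∂μ, l ≤ f x) (hB : ∀ᵐ x ∂μ, f x ≤ B) :
    essInf (fun x => (1 - (f x)⁻¹)⁻¹) μ = (1 - (essSup f μ)⁻¹)⁻¹ := by
  have hinf := le_essInf_of_ae_bounds hl hB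
  have hle := essInf_le_essSup_of_ae_bounds hl hB
  have hq : ∀ᵐ x ∂μ, (1 - (essSup f μ)⁻¹)⁻¹ ≤ (1 - (f x)⁻¹)⁻¹ := by
    filter_upwards [hl, ae_le_essSup (f := f) ⟨B, hB⟩] with x hx hx'
    exact inv_one_sub_inv_anti (by linarith) hx'
  have hq' : ∀ᵐ x ∂μ, (1 - (f x)⁻¹)⁻¹ ≤ (1 - l⁻¹)⁻¹ := by
    filter_upwards [hl] with x hx
    exact inv_one_sub_inv_anti h1 hx
  refine le_antisymm ?_ (le_essInf_of_ae_bounds hq hq')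
  set c := essInf (fun x => (1 - (f x)⁻¹)⁻¹) μ
  have hc : ∀ᵐ x ∂μ, c ≤ (1 - (f x)⁻¹)⁻¹ := ae_essInf_le ⟨_, hq⟩
  have hone := one_lt_inv_one_sub_inv (r := essSup f μ) (by linarith)
  rcases le_or_gt c 1 with hc1 | hc1
  · linarith
  · have hfc : ∀ᵐ x ∂μ, f x ≤ (1 - c⁻¹)⁻¹ := by
      filter_upwards [hc] with x hx
      simpa only [inv_one_sub_inv_involutive (f x)] using inv_one_sub_inv_anti hc1 hx
    have := inv_one_sub_inv_anti (by linarith) (essSup_le_of_ae_bounds hl hfc)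
    simpa only [inv_one_sub_inv_involutive c] using this

lemma essSup_inv_one_sub_inv (h1 : 1 < l) (hl : ∀ᵐ x ∂μ, l ≤ f x) (hB : ∀ᵐ x ∂μ, f x ≤ B) :
    essSup (fun x => (1 - (f x)⁻¹)⁻¹) μ = (1 - (essInf f μ)⁻¹)⁻¹ := by
  have hB1 : 1 < max B l := lt_max_of_lt_right h1
  have h := essInf_inv_one_sub_inv (μ := μ) (f := fun x => (1 - (f x)⁻¹)⁻¹)
    (l := (1 - (max B l)⁻¹)⁻¹) (B := (1 - l⁻¹)⁻¹) (one_lt_inv_one_sub_inv hB1)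
    (by
      filter_upwards [hl, hB] with x hx hx'
      exact inv_one_sub_inv_anti (by linarith) (hx'.trans (le_max_left _ _)))
    (by
      filter_upwards [hl] with x hx
      exact inv_one_sub_inv_anti h1 hx)
  simp only [inv_one_sub_inv_involutive (f _)] at h
  rw [h]
  exact (inv_one_sub_inv_involutive _).symm

end EssBounds

lemma rpow_inv_one_sub_inv_sub_le {t a b l C : ℝ} (ht : 0 < t) (hl : 1 < l) (hla : l ≤ a)
    (hab : a ≤ b) (h : t ^ (a - b) ≤ C) :
    t ^ ((1 - b⁻¹)⁻¹ - (1 - a⁻¹)⁻¹) ≤ max C 1 ^ ((l - 1) * (l - 1))⁻¹ := by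
  have ha : 0 < a - 1 := by linarith
  have hb : 0 < b - 1 := by linarith
  have hconj : ∀ r : ℝ, 1 < r → (1 - r⁻¹)⁻¹ = r / (r - 1) := by
    intro r hr
    have hr0 : r ≠ 0 := by linarith
    rw [← inv_div, sub_div, div_self hr0, one_div]
  have hexp : (1 - b⁻¹)⁻¹ - (1 - a⁻¹)⁻¹ = (a - b) * ((a - 1) * (b - 1))⁻¹ := by
    rw [hconj a (by linarith), hconj b (by linarith)]
    field_simp
    ring
  rw [hexp, Real.rpow_mul ht.le]
  calc (t ^ (a - b)) ^ ((a - 1) * (b - 1))⁻¹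
      ≤ max C 1 ^ ((a - 1) * (b - 1))⁻¹ :=
        Real.rpow_le_rpow (by positivity) (h.trans (le_max_left _ _)) (by positivity)
    _ ≤ max C 1 ^ ((l - 1) * (l - 1))⁻¹ := by
        have hl' : 0 < l - 1 := by linarith
        refine Real.rpow_le_rpow_of_exponent_le (le_max_right _ _) (inv_anti₀ (by positivity) ?_)
        gcongr
        exact hla.trans hab

lemma dyadicCube_eq_pi (n : ℕ) (k : ℤ) (m : Fin n → ℤ) :
    dyadicCube n k m =
      univ.pi fun i => Ico ((2 : ℝ) ^ (-k) * m i) ((2 : ℝ) ^ (-k) * (m i + 1)) := by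
  ext x
  simp [dyadicCube]

lemma IsDyadicCube.volume_toReal_pos {n : ℕ} {Q : Set (Fin n → ℝ)} (hQ : IsDyadicCube n Q) :
    0 < (volume Q).toReal := by
  obtain ⟨k, m, rfl⟩ := hQ
  rw [dyadicCube_eq_pi, volume_pi_pi, toReal_prod]
  refine Finset.prod_pos fun i _ => ?_
  have : (0 : ℝ) < 2 ^ (-k) := by positivity
  rw [Real.volume_Ico, toReal_ofReal] <;> nlinarith

/-- The conjugate of an exponent in `εLH_0` is in `εLH_0`. -/
lemma epsLH0_conj {n : ℕ} {ε : Set (Fin n → ℝ) → ℝ}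
    (hεpos : ∀ Q, IsDyadicCube n Q → 0 < ε Q) {p : (Fin n → ℝ) → ℝ} {l B : ℝ} (h1 : 1 < l)
    (hl : ∀ᵐ x ∂volume, l ≤ p x) (hB : ∀ᵐ x ∂volume, p x ≤ B)
    (h : ∃ C : ℝ, 0 < C ∧ ∀ Q, IsDyadicCube n Q →
      ((volume Q).toReal / ε Q) ^
        (essInf p (volume.restrict Q) - essSup p (volume.restrict Q)) ≤ C) :
    ∃ C : ℝ, 0 < C ∧ ∀ Q, IsDyadicCube n Q →
      ((volume Q).toReal / ε Q) ^
        (essInf (fun x => (1 - (p x)⁻¹)⁻¹) (volume.restrict Q) -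
          essSup (fun x => (1 - (p x)⁻¹)⁻¹) (volume.restrict Q)) ≤ C := by
  obtain ⟨C, -, hC⟩ := h
  refine ⟨max C 1 ^ ((l - 1) * (l - 1))⁻¹, by positivity, fun Q hQ => ?_⟩
  have hvol := hQ.volume_toReal_pos
  have : NeZero (volume.restrict Q) := ⟨by
    rw [Ne, Measure.restrict_eq_zero]
    exact (toReal_pos_iff.1 hvol).1.ne'⟩
  have hlQ := ae_restrict_of_ae (s := Q) hl
  have hBQ := ae_restrict_of_ae (s := Q) hB
  rw [essInf_inv_one_sub_inv h1 hlQ hBQ, essSup_inv_one_sub_inv h1 hlQ hBQ]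
  exact rpow_inv_one_sub_inv_sub_le (div_pos hvol (hεpos Q hQ)) h1
    (le_essInf_of_ae_bounds hlQ hBQ) (essInf_le_essSup_of_ae_bounds hlQ hBQ) (hC Q hQ)

/-- **Lemma 2.14.** Let `p` be an exponent function with `1 < p_- ≤ p_+ < ∞` and let
`p'` be its conjugate exponent, `1/p'(x) = 1 - 1/p(x)`. Then `p ∈ εLH_0(ℝⁿ)` if and
only if `p' ∈ εLH_0(ℝⁿ)`. -/
theorem epsLH0_conj_iff (n : ℕ) (ε : Set (Fin n → ℝ) → ℝ)
    (hεpos : ∀ Q, IsDyadicCube n Q → 0 < ε Q)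
    (p : (Fin n → ℝ) → ℝ) (hpMeas : Measurable p) (hp1 : ∀ x, 1 ≤ p x)
    (hpminus : 1 < essInf p volume)
    (hpplus : ∃ B : ℝ, ∀ᵐ x ∂volume, p x ≤ B) :
    (∃ C : ℝ, 0 < C ∧ ∀ Q, IsDyadicCube n Q →
      ((volume Q).toReal / ε Q) ^
        (essInf p (volume.restrict Q) - essSup p (volume.restrict Q)) ≤ C) ↔
    (∃ C : ℝ, 0 < C ∧ ∀ Q, IsDyadicCube n Q →
      ((volume Q).toReal / ε Q) ^
        (essInf (fun x => (1 - (p x)⁻¹)⁻¹) (volume.restrict Q) -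
          essSup (fun x => (1 - (p x)⁻¹)⁻¹) (volume.restrict Q)) ≤ C) := by
  obtain ⟨B, hB⟩ := hpplus
  have hl : ∀ᵐ x ∂volume, essInf p volume ≤ p x :=
    ae_essInf_le ⟨1, Filter.eventually_map.2 (.of_forall hp1)⟩
  refine ⟨epsLH0_conj hεpos hpminus hl hB, fun h => ?_⟩
  have hB1 : 1 < max B (essInf p volume) := lt_max_of_lt_right hpminus
  have h' := epsLH0_conj hεpos (p := fun x => (1 - (p x)⁻¹)⁻¹) (B := (1 - (essInf p volume)⁻¹)⁻¹)
    (one_lt_inv_one_sub_inv hB1)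
    (by
      filter_upwards [hl, hB] with x hx hx'
      exact inv_one_sub_inv_anti (by linarith) (hx'.trans (le_max_left _ _)))
    (by
      filter_upwards [hl] with x hx
      exact inv_one_sub_inv_anti hpminus hx) h
  simpa only [inv_one_sub_inv_involutive (p _)] using h'
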